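/- Let Λ be the lattice with basis (x, y, z) whose Gram matrix with respect to (x, y, z) is [[−4, 3, 3], [3, −2, 0], [3, 0, −2]], and set d := y + z. Then there is no isometry σ̃ of Λ with σ̃(x) = −x and σ̃(d) = d + 3x. (Indeed, writing σ̃(y) = k·x + l·y + m·z would force 3 = 4k − 3(l + m) and −2 = −6k + 7(l + m), which have no integer solution since the first equation forces l + m to be odd and the second forces it to be even.) -/

import Mathlib

open Matrix

/-- The Gram matrix `[[-4,3,3],[3,-2,0],[3,0,-2]]`. -/
def gram : Matrix (Fin 3) (Fin 3) ℤ := !![-4, 3, 3; 3, -2, 0; 3, 0, -2]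

/-- The bilinear form on `ℤ³` with Gram matrix `gram` w.r.t. the standard
basis `(x, y, z)`. -/
def bil (v w : Fin 3 → ℤ) : ℤ := v ⬝ᵥ gram.mulVec w

/-- The basis vectors x, y, z and d = y + z. -/
def xv : Fin 3 → ℤ := ![1, 0, 0]
def yv : Fin 3 → ℤ := ![0, 1, 0]
def zv : Fin 3 → ℤ := ![0, 0, 1]
def dv : Fin 3 → ℤ := yv + zv

/-- In the lattice with Gram matrix [[−4,3,3],[3,−2,0],[3,0,−2]]
w.r.t. (x,y,z) and d := y+z, there is no isometry σ̃ of the lattice with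
σ̃(x) = −x and σ̃(d) = d + 3x. -/
theorem no_isometry_extension :
    ¬ ∃ σ : (Fin 3 → ℤ) ≃ₗ[ℤ] (Fin 3 → ℤ),
      (∀ v w : Fin 3 → ℤ, bil (σ v) (σ w) = bil v w) ∧
      σ xv = -xv ∧ σ dv = dv + 3 • xv := by
  rintro ⟨σ, hσ, hx, hd⟩
  have h₁ := hσ yv xv
  have h₂ := hσ yv dv
  rw [hx] at h₁
  rw [hd] at h₂
  generalize σ yv = v at h₁ h₂
  simp [bil, _root_.gram, xv, yv, zv, dv, Matrix.mulVec, dotProduct, Fin.sum_univ_three] at h₁ h₂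
  omega
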